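/- Let a < b be reals and let p : [a,b] → [1,∞) be Lebesgue integrable. Suppose there exists x ∈ (a,b) such that p̄_-^x(a;b) < max{p̄_-^x(a;x), p̄_-^x(x;b)}. Then for every C ≥ 1 there exists a function f ∈ WBV_{p(·)}[a,b] such that V_a^b(p,f) > C·(V_a^x(p,f) + V_x^b(p,f)). -/

import Mathlib

open MeasureTheory Set Filter
open scoped ENNReal

/-- The harmonic mean exponent `p̄([u,v]) = ((v-u)⁻¹ ∫_u^v 1/p)⁻¹`. -/
noncomputable def pbar (p : ℝ → ℝ) (u v : ℝ) : ℝ :=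
  ((v - u)⁻¹ * ∫ t in u..v, (p t)⁻¹)⁻¹

/-- `t 0 = c < t 1 < ⋯ < t n = d` is a partition of `[c,d]`. -/
def IsPartition (c d : ℝ) (n : ℕ) (t : ℕ → ℝ) : Prop :=
  0 < n ∧ t 0 = c ∧ t n = d ∧ ∀ k < n, t k < t (k + 1)

/-- The Wiener variable-exponent variation `V_c^d(p, f)`, valued in `[0,∞]`. -/
noncomputable def wienerVar (p f : ℝ → ℝ) (c d : ℝ) : ℝ≥0∞ :=
  ⨆ (n : ℕ) (t : ℕ → ℝ) (_ : IsPartition c d n t),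
    ENNReal.ofReal (∑ k ∈ Finset.range n,
      |f (t (k + 1)) - f (t k)| ^ pbar p (t k) (t (k + 1)))

/-- The Luxemburg norm `inf {λ > 0 : V_a^b(p, f/λ) ≤ 1}`, valued in `[0,∞]`. -/
noncomputable def luxNorm (p f : ℝ → ℝ) (a b : ℝ) : ℝ≥0∞ :=
  ⨅ (l : ℝ) (_ : 0 < l) (_ : wienerVar p (fun x => f x / l) a b ≤ 1),
    ENNReal.ofReal l

/-- Membership in the space `WBV_{p(·)}[a,b]`. -/
def MemWBV (p f : ℝ → ℝ) (a b : ℝ) : Prop :=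
  f a = 0 ∧ luxNorm p f a b < ⊤


/-- `p̄_-^x(c;d) := inf { p̄([u,v]) : x ∈ [u,v] ⊆ [c,d], u < v }`. -/
noncomputable def pbarMinus (p : ℝ → ℝ) (c d x : ℝ) : ℝ :=
  sInf {r : ℝ | ∃ u v : ℝ, c ≤ u ∧ u ≤ x ∧ x ≤ v ∧ v ≤ d ∧ u < v ∧ r = pbar p u v}

lemma intervalIntegrable_inv_of_one_le {p : ℝ → ℝ} {a b u v : ℝ}
    (hp1 : ∀ t ∈ Set.Icc a b, 1 ≤ p t) (hpint : IntegrableOn p (Set.Icc a b))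
    (hau : a ≤ u) (huv : u ≤ v) (hvb : v ≤ b) :
    IntervalIntegrable (fun t => (p t)⁻¹) volume u v := by
  have h : IntegrableOn (fun t => (p t)⁻¹) (Set.Icc a b) := by
    refine Integrable.mono' (g := fun _ => (1 : ℝ)) (by simp)
      hpint.aestronglyMeasurable.aemeasurable.inv.aestronglyMeasurable ?_
    filter_upwards [ae_restrict_mem measurableSet_Icc] with t ht
    have := hp1 t ht
    rw [Real.norm_of_nonneg (by positivity)]
    exact inv_le_one_of_one_le₀ this
  exact (intervalIntegrable_iff_integrableOn_Icc_of_le huv).2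
    (h.mono_set (Set.Icc_subset_Icc hau hvb))

lemma pbar_pos {p : ℝ → ℝ} {a b u v : ℝ}
    (hp1 : ∀ t ∈ Set.Icc a b, 1 ≤ p t) (hpint : IntegrableOn p (Set.Icc a b))
    (hau : a ≤ u) (huv : u < v) (hvb : v ≤ b) : 0 < pbar p u v := by
  refine inv_pos.2 (mul_pos (inv_pos.2 (sub_pos.2 huv)) ?_)
  refine intervalIntegral.intervalIntegral_pos_of_pos_on
    (intervalIntegrable_inv_of_one_le hp1 hpint hau huv.le hvb) (fun t ht => ?_) huv
  exact inv_pos.2 (one_pos.trans_le (hp1 t ⟨hau.trans ht.1.le, ht.2.le.trans hvb⟩))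

lemma pbar_comm (p : ℝ → ℝ) (u v : ℝ) : pbar p u v = pbar p v u := by
  rw [pbar, pbar, intervalIntegral.integral_symm, ← neg_sub u v, inv_neg, neg_mul_neg]

lemma continuousAt_pbar {p : ℝ → ℝ} {a b c x : ℝ}
    (hp1 : ∀ t ∈ Set.Icc a b, 1 ≤ p t) (hpint : IntegrableOn p (Set.Icc a b))
    (hc : c ∈ Set.Icc a b) (hx : x ∈ Set.Ioo a b) (hcx : c ≠ x) :
    ContinuousAt (pbar p c) x := by
  have hab : a ≤ b := hc.1.trans hc.2
  have hpos : 0 < pbar p c x := by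
    rcases hcx.lt_or_gt with h | h
    · exact pbar_pos hp1 hpint hc.1 h hx.2.le
    · rw [pbar_comm]
      exact pbar_pos hp1 hpint hx.1.le h hc.2
  have hint := intervalIntegral.continuousOn_primitive_interval'
    (intervalIntegrable_inv_of_one_le hp1 hpint le_rfl hab le_rfl)
    (by rwa [Set.uIcc_of_le hab] : c ∈ Set.uIcc a b)
  rw [Set.uIcc_of_le hab] at hint
  have hat := hint.continuousAt (Icc_mem_nhds hx.1 hx.2)
  refine ContinuousAt.inv₀ (ContinuousAt.mul (ContinuousAt.inv₀ (by fun_prop)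
    (sub_ne_zero.2 hcx.symm)) hat) ?_
  exact (inv_pos.1 hpos).ne'

/-- The crossing of `x` by a subinterval may be taken strict on the right. -/
lemma exists_pbar_lt_right {p : ℝ → ℝ} {a b u v x q : ℝ}
    (hp1 : ∀ t ∈ Set.Icc a b, 1 ≤ p t) (hpint : IntegrableOn p (Set.Icc a b))
    (hx : x ∈ Set.Ioo a b) (hau : a ≤ u) (hux : u < x) (hxv : x ≤ v) (hvb : v ≤ b)
    (hq : pbar p u v < q) : ∃ w, x < w ∧ w ≤ b ∧ pbar p u w < q := by
  rcases hxv.eq_or_lt with rfl | h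
  · have hev := (continuousAt_pbar hp1 hpint ⟨hau, hux.le.trans hx.2.le⟩ hx
      hux.ne).eventually_lt_const hq
    obtain ⟨w, ⟨h1, h2⟩, h3⟩ := (((hev.and (Iio_mem_nhds hx.2)).filter_mono
      nhdsWithin_le_nhds).and self_mem_nhdsWithin : ∀ᶠ w in nhdsWithin x (Set.Ioi x), _).exists
    exact ⟨w, h3, le_of_lt h2, h1⟩
  · exact ⟨v, h, hvb, hq⟩

/-- The crossing of `x` by a subinterval may be taken strict on the left. -/
lemma exists_pbar_lt_left {p : ℝ → ℝ} {a b u v x q : ℝ}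
    (hp1 : ∀ t ∈ Set.Icc a b, 1 ≤ p t) (hpint : IntegrableOn p (Set.Icc a b))
    (hx : x ∈ Set.Ioo a b) (hau : a ≤ u) (hux : u ≤ x) (hxv : x < v) (hvb : v ≤ b)
    (hq : pbar p u v < q) : ∃ w, a ≤ w ∧ w < x ∧ pbar p w v < q := by
  rcases hux.eq_or_lt with rfl | h
  · rw [pbar_comm] at hq
    have hev := (continuousAt_pbar hp1 hpint ⟨hx.1.le.trans hxv.le, hvb⟩ hx
      hxv.ne').eventually_lt_const hq
    obtain ⟨w, ⟨h1, h2⟩, h3⟩ := (((hev.and (Ioi_mem_nhds hx.1)).filter_mono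
      nhdsWithin_le_nhds).and self_mem_nhdsWithin : ∀ᶠ w in nhdsWithin u (Set.Iio u), _).exists
    exact ⟨w, le_of_lt h2, h3, by rwa [pbar_comm]⟩
  · exact ⟨u, hau, h, hq⟩

lemma pbarMinus_le_pbar {p : ℝ → ℝ} {c d x u v : ℝ}
    (hp1 : ∀ t ∈ Set.Icc c d, 1 ≤ p t) (hpint : IntegrableOn p (Set.Icc c d))
    (hcu : c ≤ u) (hux : u ≤ x) (hxv : x ≤ v) (hvd : v ≤ d) (huv : u < v) :
    pbarMinus p c d x ≤ pbar p u v := by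
  refine csInf_le ⟨0, ?_⟩ ⟨u, v, hcu, hux, hxv, hvd, huv, rfl⟩
  rintro r ⟨u, v, h1, -, -, h4, h5, rfl⟩
  exact (pbar_pos hp1 hpint h1 h5 h4).le

lemma exists_pbar_lt_of_pbarMinus_lt {p : ℝ → ℝ} {c d x q : ℝ} (hcd : c < d)
    (hx : x ∈ Set.Icc c d) (h : pbarMinus p c d x < q) :
    ∃ u v, c ≤ u ∧ u ≤ x ∧ x ≤ v ∧ v ≤ d ∧ u < v ∧ pbar p u v < q := by
  obtain ⟨_, ⟨u, v, h1, h2, h3, h4, h5, rfl⟩, h6⟩ := exists_lt_of_csInf_lt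
    (by exact ⟨pbar p c d, c, d, le_rfl, hx.1, hx.2, le_rfl, hcd, rfl⟩) h
  exact ⟨u, v, h1, h2, h3, h4, h5, h6⟩

lemma IsPartition.mem_Icc {c d : ℝ} {n : ℕ} {t : ℕ → ℝ} (ht : IsPartition c d n t) {k : ℕ}
    (hk : k ≤ n) : t k ∈ Set.Icc c d := by
  obtain ⟨-, rfl, rfl, hlt⟩ := ht
  have hmono : ∀ m ≤ n, ∀ j ≤ m, t j ≤ t m := by
    intro m
    induction m with
    | zero =>
      intro _ j hj
      rw [Nat.le_zero.1 hj]
    | succ m ih =>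
      intro hm j hj
      rcases hj.eq_or_lt with rfl | hj
      · exact le_rfl
      · exact (ih (by omega) j (by omega)).trans (hlt m (by omega)).le
  exact ⟨hmono k hk 0 k.zero_le, hmono n le_rfl k hk⟩

/-- Upper bound for the variation of a multiple of a `{0,1}`-valued step. -/
lemma wienerVar_mul_step_le {p g : ℝ → ℝ} {c d h M : ℝ} (hg : Monotone g)
    (hg01 : ∀ t, g t = 0 ∨ g t = 1) (hh : 0 < h)
    (hpos : ∀ u v, c ≤ u → u < v → v ≤ d → 0 < pbar p u v)
    (hM : ∀ u v, c ≤ u → u < v → v ≤ d → g u = 0 → g v = 1 → h ^ pbar p u v ≤ M) :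
    wienerVar p (fun t => h * g t) c d ≤ ENNReal.ofReal (M * (g d - g c)) := by
  refine iSup_le fun n => iSup_le fun t => iSup_le fun ht => ENNReal.ofReal_le_ofReal ?_
  calc _ ≤ ∑ k ∈ Finset.range n, M * (g (t (k + 1)) - g (t k)) := by
        refine Finset.sum_le_sum fun k hk => ?_
        have hk := Finset.mem_range.1 hk
        have hlt := ht.2.2.2 k hk
        have hu := (ht.mem_Icc hk.le).1
        have hv := (ht.mem_Icc (Nat.succ_le_of_lt hk)).2
        have hp := hpos _ _ hu hlt hv
        have hmono := hg hlt.le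
        rcases hg01 (t k) with h0 | h0 <;> rcases hg01 (t (k + 1)) with h1 | h1
        · simp [h0, h1, Real.zero_rpow hp.ne']
        · simpa [h0, h1, abs_of_pos hh] using hM _ _ hu hlt hv h0 h1
        · linarith
        · simp [h0, h1, Real.zero_rpow hp.ne']
    _ = M * (g d - g c) := by
        rw [← Finset.mul_sum, Finset.sum_range_sub (fun k => g (t k)), ht.2.1, ht.2.2.1]

/-- The variation dominates each single increment. -/
lemma ofReal_rpow_pbar_le_wienerVar (p f : ℝ → ℝ) {a b u v : ℝ}
    (hau : a ≤ u) (huv : u < v) (hvb : v ≤ b) :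
    ENNReal.ofReal (|f v - f u| ^ pbar p u v) ≤ wienerVar p f a b := by
  suffices ∃ n t, IsPartition a b n t ∧ ∃ k < n, t k = u ∧ t (k + 1) = v by
    obtain ⟨n, t, ht, k, hk, rfl, rfl⟩ := this
    refine le_trans (ENNReal.ofReal_le_ofReal ?_)
      (le_iSup_of_le n (le_iSup_of_le t (le_iSup_of_le ht le_rfl)))
    exact Finset.single_le_sum
      (f := fun k => |f (t (k + 1)) - f (t k)| ^ pbar p (t k) (t (k + 1)))
      (fun _ _ => by positivity) (Finset.mem_range.2 hk)
  rcases hau.eq_or_lt with rfl | hau <;> rcases hvb.eq_or_lt with rfl | hvb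
  · refine ⟨1, fun k => if k = 0 then a else v, ⟨by simp, by simp, by simp, ?_⟩,
      0, by simp, by simp, by simp⟩
    intro k hk
    interval_cases k
    simpa using huv
  · refine ⟨2, fun k => if k = 0 then a else if k = 1 then v else b,
      ⟨by simp, by simp, by simp, ?_⟩, 0, by simp, by simp, by simp⟩
    intro k hk
    interval_cases k <;> simpa
  · refine ⟨2, fun k => if k = 0 then a else if k = 1 then u else v,
      ⟨by simp, by simp, by simp, ?_⟩, 1, by simp, by simp, by simp⟩
    intro k hk
    interval_cases k <;> simpa
  · refine ⟨3, fun k => if k = 0 then a else if k = 1 then u else if k = 2 then v else b,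
      ⟨by simp, by simp, by simp, ?_⟩, 1, by simp, by simp, by simp⟩
    intro k hk
    interval_cases k <;> simpa

lemma exists_mul_rpow_lt_rpow {C s q : ℝ} (hC : 1 ≤ C) (hsq : s < q) :
    ∃ h : ℝ, 0 < h ∧ h ≤ 1 ∧ C * h ^ q < h ^ s := by
  have hC1 : 0 < C + 1 := by linarith
  have hd : 0 < q - s := sub_pos.2 hsq
  have hpos : 0 < (C + 1)⁻¹ ^ (q - s)⁻¹ := Real.rpow_pos_of_pos (inv_pos.2 hC1) _
  refine ⟨(C + 1)⁻¹ ^ (q - s)⁻¹, hpos, Real.rpow_le_one (inv_pos.2 hC1).le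
    (inv_le_one_of_one_le₀ (by linarith)) (inv_pos.2 hd).le, ?_⟩
  set h := (C + 1)⁻¹ ^ (q - s)⁻¹ with hh
  have hpow : h ^ (q - s) = (C + 1)⁻¹ := by
    rw [hh, ← Real.rpow_mul (inv_pos.2 hC1).le, inv_mul_cancel₀ hd.ne', Real.rpow_one]
  have hs : 0 < h ^ s := Real.rpow_pos_of_pos hpos s
  have hq : h ^ q = (C + 1)⁻¹ * h ^ s := by
    rw [← hpow, ← Real.rpow_add hpos, sub_add_cancel]
  rw [hq, ← mul_assoc, ← div_eq_mul_inv]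
  exact mul_lt_of_lt_one_left hs ((div_lt_one hC1).2 (by linarith))

/-- A small `{0,1}`-valued step whose jumps inside `[a,x]` and `[x,b]` only meet exponents at
least `q`, but which jumps across some interval of exponent below `q`, violates additivity. -/
lemma exists_step_violating {p g : ℝ → ℝ} {a b x u v q C : ℝ}
    (hpos : ∀ u v, a ≤ u → u < v → v ≤ b → 0 < pbar p u v)
    (hg : Monotone g) (hg01 : ∀ t, g t = 0 ∨ g t = 1) (hga : g a = 0) (hgb : g b = 1)
    (hx : x ∈ Set.Ioo a b) (hau : a ≤ u) (huv : u < v) (hvb : v ≤ b)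
    (hgu : g u = 0) (hgv : g v = 1) (hq : pbar p u v < q)
    (hleft : ∀ u v, a ≤ u → u < v → v ≤ x → g u = 0 → g v = 1 → q ≤ pbar p u v)
    (hright : ∀ u v, x ≤ u → u < v → v ≤ b → g u = 0 → g v = 1 → q ≤ pbar p u v)
    (hC : 1 ≤ C) :
    ∃ f : ℝ → ℝ, MemWBV p f a b ∧
      ENNReal.ofReal C * (wienerVar p f a x + wienerVar p f x b) < wienerVar p f a b := by
  obtain ⟨h, h0, h1, hlt⟩ := exists_mul_rpow_lt_rpow hC hq
  refine ⟨fun t => h * g t, ⟨by simp [hga], ?_⟩, ?_⟩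
  · have hvar : wienerVar p (fun t => h * g t / 1) a b ≤ 1 := by
      simp only [div_one]
      refine (wienerVar_mul_step_le (M := 1) hg hg01 h0 hpos ?_).trans (by simp [hga, hgb])
      exact fun u v hu huv hv _ _ => Real.rpow_le_one h0.le h1 (hpos u v hu huv hv).le
    exact lt_of_le_of_lt (iInf_le_of_le 1 (iInf_le_of_le one_pos (iInf_le_of_le hvar le_rfl)))
      ENNReal.ofReal_lt_top
  · have hV1 := wienerVar_mul_step_le (M := h ^ q) hg hg01 h0
      (fun u v hu huv hv => hpos u v hu huv (hv.trans hx.2.le))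
      (fun u v hu huv hv hgu hgv =>
        Real.rpow_le_rpow_of_exponent_ge h0 h1 (hleft u v hu huv hv hgu hgv))
    have hV2 := wienerVar_mul_step_le (M := h ^ q) hg hg01 h0
      (fun u v hu huv hv => hpos u v (hx.1.le.trans hu) huv hv)
      (fun u v hu huv hv hgu hgv =>
        Real.rpow_le_rpow_of_exponent_ge h0 h1 (hright u v hu huv hv hgu hgv))
    have hV := ofReal_rpow_pbar_le_wienerVar p (fun t => h * g t) hau huv hvb
    simp only [hgu, hgv, mul_one, mul_zero, sub_zero, abs_of_pos h0] at hV
    have hhq : 0 ≤ h ^ q := Real.rpow_nonneg h0.le q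
    refine lt_of_lt_of_le ?_ hV
    calc _ ≤ ENNReal.ofReal C * (ENNReal.ofReal (h ^ q * (g x - g a)) +
          ENNReal.ofReal (h ^ q * (g b - g x))) := by gcongr
      _ = ENNReal.ofReal (C * h ^ q) := by
        rw [← ENNReal.ofReal_add (mul_nonneg hhq (sub_nonneg.2 (hg hx.1.le)))
          (mul_nonneg hhq (sub_nonneg.2 (hg hx.2.le))), ← ENNReal.ofReal_mul (by linarith),
          hga, hgb]
        congr 1
        ring
      _ < ENNReal.ofReal (h ^ pbar p u v) :=
        (ENNReal.ofReal_lt_ofReal_iff (Real.rpow_pos_of_pos h0 _)).2 hlt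

lemma monotone_indicator_one_of_isUpperSet {S : Set ℝ} (hS : IsUpperSet S) :
    Monotone (S.indicator (1 : ℝ → ℝ)) := by
  intro s t hst
  by_cases hs : s ∈ S
  · simp [hs, hS hst hs]
  · rw [Set.indicator_of_notMem hs]
    exact Set.indicator_nonneg (fun _ _ => zero_le_one) t

/-- if `p̄_-^x(a;b) < max {p̄_-^x(a;x), p̄_-^x(x;b)}` for some `x ∈ (a,b)`,
then for each `C ≥ 1` there is `f ∈ WBV_{p(·)}[a,b]` with
`V_a^b(p,f) > C (V_a^x(p,f) + V_x^b(p,f))`. -/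
theorem wbv_additivity_fails (a b : ℝ) (hab : a < b) (p : ℝ → ℝ)
    (hp1 : ∀ t ∈ Set.Icc a b, 1 ≤ p t)
    (hpint : MeasureTheory.IntegrableOn p (Set.Icc a b))
    (x : ℝ) (hx : x ∈ Set.Ioo a b)
    (hcond : pbarMinus p a b x < max (pbarMinus p a x x) (pbarMinus p x b x)) :
    ∀ C : ℝ, 1 ≤ C → ∃ f : ℝ → ℝ, MemWBV p f a b ∧
      ENNReal.ofReal C * (wienerVar p f a x + wienerVar p f x b) < wienerVar p f a b := by
  intro C hC
  have hpos : ∀ u v, a ≤ u → u < v → v ≤ b → 0 < pbar p u v :=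
    fun u v hu huv hv => pbar_pos hp1 hpint hu huv hv
  rcases lt_max_iff.1 hcond with hlt | hlt
  · have hq : ∀ u, a ≤ u → u < x → pbarMinus p a x x ≤ pbar p u x := fun u hu hux =>
      pbarMinus_le_pbar (fun t ht => hp1 t ⟨ht.1, ht.2.trans hx.2.le⟩)
        (hpint.mono_set (Set.Icc_subset_Icc_right hx.2.le)) hu hux.le le_rfl le_rfl hux
    obtain ⟨u, v, hau, hux, hxv, hvb, huv, hlt⟩ :=
      exists_pbar_lt_of_pbarMinus_lt hab ⟨hx.1.le, hx.2.le⟩ hlt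
    have hxv : x < v := by
      refine hxv.lt_of_ne ?_
      rintro rfl
      exact (hq u hau huv).not_gt hlt
    obtain ⟨w, haw, hwx, hlt⟩ := exists_pbar_lt_left hp1 hpint hx hau hux hxv hvb hlt
    refine exists_step_violating (g := (Set.Ici x).indicator 1) hpos
      (monotone_indicator_one_of_isUpperSet (isUpperSet_Ici x))
      (fun t => by by_cases ht : x ≤ t <;> simp [ht]) (by simp [hx.1]) (by simp [hx.2.le]) hx haw
      (hwx.trans hxv) hvb (by simp [hwx]) (by simp [hxv.le]) hlt ?_ ?_ hC
    · intro s t hs hst ht _ hgt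
      obtain rfl : t = x := ht.antisymm (by simpa [Set.indicator_apply] using hgt)
      exact hq s hs hst
    · intro s t hs _ _ hgs _
      simp [hs] at hgs
  · have hq : ∀ v, x < v → v ≤ b → pbarMinus p x b x ≤ pbar p x v := fun v hxv hv =>
      pbarMinus_le_pbar (fun t ht => hp1 t ⟨hx.1.le.trans ht.1, ht.2⟩)
        (hpint.mono_set (Set.Icc_subset_Icc_left hx.1.le)) le_rfl le_rfl hxv.le hv hxv
    obtain ⟨u, v, hau, hux, hxv, hvb, huv, hlt⟩ :=
      exists_pbar_lt_of_pbarMinus_lt hab ⟨hx.1.le, hx.2.le⟩ hlt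
    have hux : u < x := by
      refine hux.lt_of_ne ?_
      rintro rfl
      exact (hq v huv hvb).not_gt hlt
    obtain ⟨w, hxw, hwb, hlt⟩ := exists_pbar_lt_right hp1 hpint hx hau hux hxv hvb hlt
    refine exists_step_violating (g := (Set.Ioi x).indicator 1) hpos
      (monotone_indicator_one_of_isUpperSet (isUpperSet_Ioi x))
      (fun t => by by_cases ht : x < t <;> simp [ht]) (by simp [hx.1.le]) (by simp [hx.2]) hx hau
      (hux.trans hxw) hwb (by simp [hux.le]) (by simp [hxw]) hlt ?_ ?_ hC
    · intro s t _ _ ht _ hgt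
      simp [ht.not_gt] at hgt
    · intro s t hs hst ht hgs _
      obtain rfl : s = x := le_antisymm (by simpa [Set.indicator_apply] using hgs) hs
      exact hq t hst ht
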